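/- Let X : ℝ⁴ → ℝ be a harmonic polynomial homogeneous of degree 1 whose restriction to the unit sphere S³ satisfies ∫_{S³} X² dA = 2π². Let F₁(r) = r^{-3}, F₂(r) = r^{-1}, F₃(r) = r, F₄(r) = r ln r, F₅(r) = r³, F₆(r) = r⁵, and for 1 ≤ i ≤ 6 let uᵢ(x) = Fᵢ(|x|) X(x/|x|) on ℝ⁴ \ {0}. For r > 0 let N(r) be the symmetric 6×6 real matrix whose only nonzero entries are N₂₂ = −3r^{-4}, N₂₄ = N₄₂ = 3r^{-2}, N₂₆ = N₆₂ = 24r², N₄₄ = 4 ln r, N₄₅ = N₅₄ = 3r², N₅₅ = 9r⁴, N₅₆ = N₆₅ = 24r⁶, N₆₆ = 96r⁸. Then for all 0 < τ < σ < ∞ and all 1 ≤ i, j ≤ 6, ∫_{B_σ(0)\B_τ(0)} ⟨∇Δuᵢ(x), ∇Δuⱼ(x)⟩ dx = 16 · 2π² · (N(σ) − N(τ))ᵢⱼ. -/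

import Mathlib

open scoped InnerProductSpace

noncomputable section

/-- The Euclidean Laplacian on `ℝ⁴`, `Δu = Σ_{i=1}^4 ∂²u/∂x_i²`. -/
def lap (u : EuclideanSpace ℝ (Fin 4) → ℝ) (x : EuclideanSpace ℝ (Fin 4)) : ℝ :=
  ∑ i : Fin 4,
    fderiv ℝ (fun y => fderiv ℝ u y (EuclideanSpace.single i 1)) x (EuclideanSpace.single i 1)

/-- `P : ℝ⁴ → ℝ` is a harmonic polynomial homogeneous of degree `h`. -/
def IsHarmonicHomog (h : ℕ) (P : EuclideanSpace ℝ (Fin 4) → ℝ) : Prop :=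
  (∃ p : MvPolynomial (Fin 4) ℝ, p.IsHomogeneous h ∧
    ∀ x : EuclideanSpace ℝ (Fin 4), P x = MvPolynomial.eval (fun i => x i) p) ∧
  ∀ x, lap P x = 0

/-- The radial profiles `F₁(r) = r⁻³, F₂ = r⁻¹, F₃ = r, F₄ = r ln r, F₅ = r³, F₆ = r⁵`. -/
def FF : Fin 6 → ℝ → ℝ :=
  ![fun r => (r ^ 3)⁻¹, fun r => r⁻¹, fun r => r,
    fun r => r * Real.log r, fun r => r ^ 3, fun r => r ^ 5]

/-- The symmetric matrix `N(r)` of STATEMENT 10. -/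
def Nmat (r : ℝ) : Matrix (Fin 6) (Fin 6) ℝ :=
  !![0, 0, 0, 0, 0, 0;
     0, -3 * (r ^ 4)⁻¹, 0, 3 * (r ^ 2)⁻¹, 0, 24 * r ^ 2;
     0, 0, 0, 0, 0, 0;
     0, 3 * (r ^ 2)⁻¹, 0, 4 * Real.log r, 3 * r ^ 2, 0;
     0, 0, 0, 3 * r ^ 2, 9 * r ^ 4, 24 * r ^ 6;
     0, 24 * r ^ 2, 0, 0, 24 * r ^ 6, 96 * r ^ 8]

open MeasureTheory Set Filter Topology

/-- The profile `gᵢ` with `Fᵢ(r) = r gᵢ(r²)`. -/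
def profile : Fin 6 → ℝ → ℝ :=
  ![fun s => (s ^ 2)⁻¹, fun s => s⁻¹, fun _ => 1, fun s => Real.log s / 2, fun s => s,
    fun s => s ^ 2]

/-- The derivative of `profile`. -/
def profileDeriv : Fin 6 → ℝ → ℝ :=
  ![fun s => -2 * (s ^ 3)⁻¹, fun s => -(s ^ 2)⁻¹, fun _ => 0, fun s => s⁻¹ / 2, fun _ => 1,
    fun s => 2 * s]

/-- The second derivative of `profile`. -/
def profileDeriv₂ : Fin 6 → ℝ → ℝ :=
  ![fun s => 6 * (s ^ 4)⁻¹, fun s => 2 * (s ^ 3)⁻¹, fun _ => 0, fun s => -(s ^ 2)⁻¹ / 2,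
    fun _ => 0, fun _ => 2]

/-- The profile `hᵢ` with `Δ(gᵢ(|x|²) ⟨a, x⟩) = hᵢ(|x|²) ⟨a, x⟩`. -/
def lapProfile : Fin 6 → ℝ → ℝ :=
  ![fun _ => 0, fun s => -4 * (s ^ 2)⁻¹, fun _ => 0, fun s => 4 * s⁻¹, fun _ => 12,
    fun s => 32 * s]

/-- The derivative of `lapProfile`. -/
def lapProfileDeriv : Fin 6 → ℝ → ℝ :=
  ![fun _ => 0, fun s => 8 * (s ^ 3)⁻¹, fun _ => 0, fun s => -4 * (s ^ 2)⁻¹, fun _ => 0,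
    fun _ => 32]

/-- The derivative of `Nmat`. -/
def NmatDeriv (r : ℝ) : Matrix (Fin 6) (Fin 6) ℝ :=
  !![0, 0, 0, 0, 0, 0;
     0, 12 * (r ^ 5)⁻¹, 0, -6 * (r ^ 3)⁻¹, 0, 48 * r;
     0, 0, 0, 0, 0, 0;
     0, -6 * (r ^ 3)⁻¹, 0, 4 * r⁻¹, 6 * r, 0;
     0, 0, 0, 6 * r, 36 * r ^ 3, 144 * r ^ 5;
     0, 48 * r, 0, 0, 144 * r ^ 5, 768 * r ^ 7]

theorem hasDerivAt_inv_pow (n : ℕ) {s : ℝ} (hs : s ≠ 0) :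
    HasDerivAt (fun s : ℝ => (s ^ n)⁻¹) (-n * (s ^ (n + 1))⁻¹) s := by
  refine ((hasDerivAt_pow n s).fun_inv (pow_ne_zero n hs)).congr_deriv ?_
  rcases n with _ | n
  · simp
  · field_simp
    simp
    ring

theorem hasDerivAt_profile (i : Fin 6) {s : ℝ} (hs : s ≠ 0) :
    HasDerivAt (profile i) (profileDeriv i s) s := by
  fin_cases i
  · simpa [profile, profileDeriv] using hasDerivAt_inv_pow 2 hs
  · simpa [profile, profileDeriv] using hasDerivAt_inv hs
  · simpa [profile, profileDeriv] using hasDerivAt_const s (1 : ℝ)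
  · simpa [profile, profileDeriv] using (Real.hasDerivAt_log hs).div_const 2
  · simpa [profile, profileDeriv] using hasDerivAt_id' s
  · simpa [profile, profileDeriv] using hasDerivAt_pow 2 s

theorem hasDerivAt_profileDeriv (i : Fin 6) {s : ℝ} (hs : s ≠ 0) :
    HasDerivAt (profileDeriv i) (profileDeriv₂ i s) s := by
  fin_cases i
  · refine ((hasDerivAt_inv_pow 3 hs).const_mul (-2)).congr_deriv ?_
    simp [profileDeriv₂]; ring
  · refine (hasDerivAt_inv_pow 2 hs).fun_neg.congr_deriv ?_
    simp [profileDeriv₂]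
  · simpa [profileDeriv, profileDeriv₂] using hasDerivAt_const s (0 : ℝ)
  · simpa [profileDeriv, profileDeriv₂] using (hasDerivAt_inv hs).div_const 2
  · simpa [profileDeriv, profileDeriv₂] using hasDerivAt_const s (1 : ℝ)
  · simpa [profileDeriv, profileDeriv₂] using (hasDerivAt_id' s).const_mul 2

theorem hasDerivAt_lapProfile (i : Fin 6) {s : ℝ} (hs : s ≠ 0) :
    HasDerivAt (lapProfile i) (lapProfileDeriv i s) s := by
  fin_cases i
  · simpa [lapProfile, lapProfileDeriv] using hasDerivAt_const s (0 : ℝ)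
  · refine ((hasDerivAt_inv_pow 2 hs).const_mul (-4)).congr_deriv ?_
    simp [lapProfileDeriv]; ring
  · simpa [lapProfile, lapProfileDeriv] using hasDerivAt_const s (0 : ℝ)
  · simpa [lapProfile, lapProfileDeriv] using (hasDerivAt_inv hs).const_mul 4
  · simpa [lapProfile, lapProfileDeriv] using hasDerivAt_const s (12 : ℝ)
  · simpa [lapProfile, lapProfileDeriv] using (hasDerivAt_id' s).const_mul 32

theorem lapProfile_eq (i : Fin 6) {s : ℝ} (hs : s ≠ 0) :
    4 * s * profileDeriv₂ i s + 12 * profileDeriv i s = lapProfile i s := by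
  fin_cases i <;> simp [profileDeriv, profileDeriv₂, lapProfile] <;> field_simp <;> ring

theorem continuousOn_lapProfileDeriv (i : Fin 6) :
    ContinuousOn (lapProfileDeriv i) {0}ᶜ := by
  intro s hs
  have hs : s ≠ 0 := hs
  apply ContinuousAt.continuousWithinAt
  fin_cases i <;> simp only [lapProfileDeriv] <;> simp <;> fun_prop (disch := simpa)

theorem continuousOn_lapProfile (i : Fin 6) : ContinuousOn (lapProfile i) {0}ᶜ :=
  fun _ hs => (hasDerivAt_lapProfile i hs).continuousAt.continuousWithinAt

theorem hasDerivAt_Nmat (i j : Fin 6) {r : ℝ} (hr : r ≠ 0) :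
    HasDerivAt (fun r => Nmat r i j) (NmatDeriv r i j) r := by
  have h0 := hasDerivAt_const r (0 : ℝ)
  have h1 : HasDerivAt (fun r : ℝ => -3 * (r ^ 4)⁻¹) (12 * (r ^ 5)⁻¹) r := by
    refine ((hasDerivAt_inv_pow 4 hr).const_mul (-3)).congr_deriv ?_
    push_cast; ring
  have h2 : HasDerivAt (fun r : ℝ => 3 * (r ^ 2)⁻¹) (-6 * (r ^ 3)⁻¹) r := by
    refine ((hasDerivAt_inv_pow 2 hr).const_mul 3).congr_deriv ?_
    push_cast; ring
  have h3 := (Real.hasDerivAt_log hr).const_mul 4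
  have h4 (c d : ℝ) (n : ℕ) (h : d = c * (n + 1)) :
      HasDerivAt (fun r : ℝ => c * r ^ (n + 1)) (d * r ^ n) r := by
    refine ((hasDerivAt_pow (n + 1) r).const_mul c).congr_deriv ?_
    rw [h, Nat.add_sub_cancel]; push_cast; ring
  have h5 := h4 24 48 1 (by norm_num)
  have h6 := h4 3 6 1 (by norm_num)
  have h7 := h4 9 36 3 (by norm_num)
  have h8 := h4 24 144 5 (by norm_num)
  have h9 := h4 96 768 7 (by norm_num)
  simp only [pow_one] at h5 h6
  fin_cases i <;> fin_cases j <;> first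
    | exact h0 | exact h1 | exact h2 | exact h3 | exact h5 | exact h6 | exact h7 | exact h8
    | exact h9

theorem FF_eq_mul_profile (i : Fin 6) {r : ℝ} (hr : 0 < r) : FF i r = r * profile i (r ^ 2) := by
  fin_cases i <;> simp [FF, profile] <;> field_simp

/-- The angular average of `⟨∇Δuᵢ, ∇Δuⱼ⟩` in terms of the profiles of the Laplacians. -/
theorem NmatDeriv_eq (i j : Fin 6) {r : ℝ} (hr : r ≠ 0) :
    16 * NmatDeriv r i j = r ^ 3 * (4 * (lapProfile i (r ^ 2) * lapProfile j (r ^ 2))) +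
      r ^ 3 * ((2 * lapProfile i (r ^ 2) * lapProfileDeriv j (r ^ 2) +
        2 * lapProfileDeriv i (r ^ 2) * lapProfile j (r ^ 2) +
        4 * r ^ 2 * lapProfileDeriv i (r ^ 2) * lapProfileDeriv j (r ^ 2)) * r ^ 2) := by
  fin_cases i <;> fin_cases j <;>
    simp [NmatDeriv, lapProfile, lapProfileDeriv] <;> field_simp <;> ring

section Calculus

variable {E : Type*} [NormedAddCommGroup E] [InnerProductSpace ℝ E]

theorem hasFDerivAt_radial_mul_inner {g : ℝ → ℝ} {g' : ℝ} {y : E} (a : E)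
    (hg : HasDerivAt g g' (‖y‖ ^ 2)) :
    HasFDerivAt (fun y : E => g (‖y‖ ^ 2) * ⟪a, y⟫_ℝ)
      ((2 * g' * ⟪a, y⟫_ℝ) • innerSL ℝ y + g (‖y‖ ^ 2) • innerSL ℝ a) y := by
  have h1 : HasFDerivAt (fun y : E => ‖y‖ ^ 2) (2 • innerSL ℝ y) y :=
    (hasStrictFDerivAt_norm_sq y).hasFDerivAt
  have h2 : HasFDerivAt (fun y : E => ⟪a, y⟫_ℝ) (innerSL ℝ a) y := (innerSL ℝ a).hasFDerivAt
  refine ((hg.comp_hasFDerivAt y h1).mul h2).congr_fderiv ?_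
  ext v
  simp
  ring

theorem fderiv_fderiv_radial_mul_inner {g g₁ : ℝ → ℝ} {g₂ : ℝ}
    (hg : ∀ s ≠ 0, HasDerivAt g (g₁ s) s) (a e : E) {x : E} (hx : x ≠ 0)
    (hg₁ : HasDerivAt g₁ g₂ (‖x‖ ^ 2)) :
    fderiv ℝ (fun y => fderiv ℝ (fun y : E => g (‖y‖ ^ 2) * ⟪a, y⟫_ℝ) y e) x e =
      4 * g₂ * ⟪a, x⟫_ℝ * ⟪x, e⟫_ℝ ^ 2 + 4 * g₁ (‖x‖ ^ 2) * (⟪x, e⟫_ℝ * ⟪a, e⟫_ℝ)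
        + 2 * g₁ (‖x‖ ^ 2) * ⟪a, x⟫_ℝ * ‖e‖ ^ 2 := by
  have hne : ∀ y : E, y ≠ 0 → ‖y‖ ^ 2 ≠ 0 := fun y hy => by simpa
  have hev : (fun y => fderiv ℝ (fun y : E => g (‖y‖ ^ 2) * ⟪a, y⟫_ℝ) y e) =ᶠ[𝓝 x]
      fun y => 2 * (g₁ (‖y‖ ^ 2) * ⟪a, y⟫_ℝ) * ⟪e, y⟫_ℝ + g (‖y‖ ^ 2) * ⟪a, e⟫_ℝ := by
    filter_upwards [isOpen_ne.mem_nhds hx] with y hy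
    rw [(hasFDerivAt_radial_mul_inner a (hg _ (hne y hy))).fderiv]
    simp only [add_apply, smul_apply, innerSL_apply_apply,
      smul_eq_mul, real_inner_comm y e]
    ring
  have h1 := ((hasFDerivAt_radial_mul_inner a hg₁).const_mul 2).fun_mul
    ((innerSL ℝ e).hasFDerivAt (x := x))
  have h2 : HasFDerivAt (fun y : E => g (‖y‖ ^ 2) * ⟪a, e⟫_ℝ)
      (⟪a, e⟫_ℝ • g₁ (‖x‖ ^ 2) • 2 • innerSL ℝ x) x :=
    ((hg _ (hne x hx)).comp_hasFDerivAt x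
      (hasStrictFDerivAt_norm_sq x).hasFDerivAt).mul_const ⟪a, e⟫_ℝ
  have h3 := h1.fun_add h2
  simp only [innerSL_apply_apply] at h3
  rw [hev.fderiv_eq, h3.fderiv]
  simp [real_inner_comm x e]
  ring

theorem gradient_radial_mul_inner [CompleteSpace E] {g : ℝ → ℝ} {g' : ℝ} {y : E} (a : E)
    (hg : HasDerivAt g g' (‖y‖ ^ 2)) :
    gradient (fun y : E => g (‖y‖ ^ 2) * ⟪a, y⟫_ℝ) y =
      (2 * g' * ⟪a, y⟫_ℝ) • y + g (‖y‖ ^ 2) • a := by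
  refine HasGradientAt.gradient ?_
  rw [hasGradientAt_iff_hasFDerivAt]
  refine (hasFDerivAt_radial_mul_inner a hg).congr_fderiv ?_
  ext v
  simp

end Calculus

theorem lap_radial_mul_inner {g g₁ : ℝ → ℝ} {g₂ : ℝ}
    (hg : ∀ s ≠ 0, HasDerivAt g (g₁ s) s) (a : EuclideanSpace ℝ (Fin 4))
    {x : EuclideanSpace ℝ (Fin 4)} (hx : x ≠ 0) (hg₁ : HasDerivAt g₁ g₂ (‖x‖ ^ 2)) :
    lap (fun y => g (‖y‖ ^ 2) * ⟪a, y⟫_ℝ) x =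
      (4 * ‖x‖ ^ 2 * g₂ + 12 * g₁ (‖x‖ ^ 2)) * ⟪a, x⟫_ℝ := by
  have h1 : ∑ i, x i ^ 2 = ‖x‖ ^ 2 := (EuclideanSpace.real_norm_sq_eq x).symm
  have h2 : ∑ i, x i * a i = ⟪a, x⟫_ℝ := by simp [PiLp.inner_apply]
  simp only [lap, fderiv_fderiv_radial_mul_inner hg a _ hx hg₁, Finset.sum_add_distrib,
    ← Finset.mul_sum]
  simp [EuclideanSpace.inner_single_right, h1, h2]
  ring

/-- A polynomial that is homogeneous of degree one is a linear form. -/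
theorem MvPolynomial.IsHomogeneous.exists_eval_eq_inner {p : MvPolynomial (Fin 4) ℝ}
    (hp : p.IsHomogeneous 1) : ∃ a : EuclideanSpace ℝ (Fin 4),
      ∀ x : EuclideanSpace ℝ (Fin 4), MvPolynomial.eval (fun i => x i) p = ⟪a, x⟫_ℝ := by
  have h : p ∈ Submodule.span ℝ (Set.range (MvPolynomial.X : Fin 4 → MvPolynomial (Fin 4) ℝ)) := by
    rw [← MvPolynomial.homogeneousSubmodule_one_eq_span_X]
    exact hp
  clear hp
  induction h using Submodule.span_induction with
  | mem p hp =>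
    obtain ⟨i, rfl⟩ := hp
    exact ⟨EuclideanSpace.single i 1, fun x => by simp [EuclideanSpace.inner_single_left]⟩
  | zero => exact ⟨0, by simp⟩
  | add p q _ _ hp hq =>
    obtain ⟨a, ha⟩ := hp
    obtain ⟨b, hb⟩ := hq
    exact ⟨a + b, fun x => by rw [map_add, ha, hb, inner_add_left]⟩
  | smul c p _ hp =>
    obtain ⟨a, ha⟩ := hp
    exact ⟨c • a, fun x => by rw [MvPolynomial.smul_eval, ha, real_inner_smul_left]⟩

theorem gradient_lap_eq (i : Fin 6) (a : EuclideanSpace ℝ (Fin 4))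
    {x : EuclideanSpace ℝ (Fin 4)} (hx : x ≠ 0) :
    gradient (lap fun y => FF i ‖y‖ * ⟪a, ‖y‖⁻¹ • y⟫_ℝ) x =
      (2 * lapProfileDeriv i (‖x‖ ^ 2) * ⟪a, x⟫_ℝ) • x + lapProfile i (‖x‖ ^ 2) • a := by
  have hne : ∀ y : EuclideanSpace ℝ (Fin 4), y ≠ 0 → ‖y‖ ^ 2 ≠ 0 := fun y hy => by simpa
  have hu : (fun y : EuclideanSpace ℝ (Fin 4) => FF i ‖y‖ * ⟪a, ‖y‖⁻¹ • y⟫_ℝ) =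
      fun y => profile i (‖y‖ ^ 2) * ⟪a, y⟫_ℝ := by
    ext y
    rcases eq_or_ne y 0 with rfl | hy
    · simp
    · have : ‖y‖ ≠ 0 := by simpa
      rw [FF_eq_mul_profile i (norm_pos_iff.2 hy), inner_smul_right]
      field_simp
  have hev : lap (fun y => profile i (‖y‖ ^ 2) * ⟪a, y⟫_ℝ) =ᶠ[𝓝 x]
      fun y => lapProfile i (‖y‖ ^ 2) * ⟪a, y⟫_ℝ := by
    filter_upwards [isOpen_ne.mem_nhds hx] with y hy
    rw [lap_radial_mul_inner (fun s hs => hasDerivAt_profile i hs) a hy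
      (hasDerivAt_profileDeriv i (hne y hy)), lapProfile_eq i (hne y hy)]
  rw [hu, hev.gradient_eq, gradient_radial_mul_inner a (hasDerivAt_lapProfile i (hne x hx))]

theorem inner_gradient_lap_eq (i j : Fin 6) (a : EuclideanSpace ℝ (Fin 4))
    {x : EuclideanSpace ℝ (Fin 4)} (hx : x ≠ 0) :
    ⟪gradient (lap fun y => FF i ‖y‖ * ⟪a, ‖y‖⁻¹ • y⟫_ℝ) x,
      gradient (lap fun y => FF j ‖y‖ * ⟪a, ‖y‖⁻¹ • y⟫_ℝ) x⟫_ℝ =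
      ‖a‖ ^ 2 * (lapProfile i (‖x‖ ^ 2) * lapProfile j (‖x‖ ^ 2)) +
      (2 * lapProfile i (‖x‖ ^ 2) * lapProfileDeriv j (‖x‖ ^ 2) +
        2 * lapProfileDeriv i (‖x‖ ^ 2) * lapProfile j (‖x‖ ^ 2) +
        4 * ‖x‖ ^ 2 * lapProfileDeriv i (‖x‖ ^ 2) * lapProfileDeriv j (‖x‖ ^ 2)) * ‖x‖ ^ 2 *
        ⟪a, ‖x‖⁻¹ • x⟫_ℝ ^ 2 := by
  have : ‖x‖ ≠ 0 := by simpa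
  rw [gradient_lap_eq i a hx, gradient_lap_eq j a hx]
  simp only [inner_add_left, inner_add_right, inner_smul_left,
    inner_smul_right, real_inner_self_eq_norm_sq, real_inner_comm x a, conj_trivial]
  field_simp
  ring

theorem integral_norm_mul_unit (f : ℝ → ℝ) (ψ : EuclideanSpace ℝ (Fin 4) → ℝ) :
    ∫ x : EuclideanSpace ℝ (Fin 4), f ‖x‖ * ψ (‖x‖⁻¹ • x) =
      (∫ y : Metric.sphere (0 : EuclideanSpace ℝ (Fin 4)) 1, ψ y ∂(volume.toSphere)) *
        ∫ r in Ioi (0 : ℝ), r ^ 3 * f r := by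
  set μ : Measure (EuclideanSpace ℝ (Fin 4)) := volume
  have hdim : Module.finrank ℝ (EuclideanSpace ℝ (Fin 4)) - 1 = 3 := by simp
  calc
    ∫ x, f ‖x‖ * ψ (‖x‖⁻¹ • x) ∂μ
      = ∫ x : ({0}ᶜ : Set (EuclideanSpace ℝ (Fin 4))),
          f ‖x.1‖ * ψ (‖x.1‖⁻¹ • x.1) ∂(μ.comap (↑)) := by
      rw [integral_subtype_comap (measurableSet_singleton _).compl
        fun x => f ‖x‖ * ψ (‖x‖⁻¹ • x), restrict_compl_singleton]
    _ = ∫ z, ψ z.1 * f z.2 ∂μ.toSphere.prod (.volumeIoiPow 3) := by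
      rw [← hdim, ← μ.measurePreserving_homeomorphUnitSphereProd.integral_comp
        (Homeomorph.measurableEmbedding _)]
      simp [mul_comm]
    _ = (∫ y, ψ y ∂μ.toSphere) * ∫ r : Ioi (0 : ℝ), f r ∂.volumeIoiPow 3 :=
      integral_prod_mul (fun y : Metric.sphere (0 : EuclideanSpace ℝ (Fin 4)) 1 => ψ y)
        fun r : Ioi (0 : ℝ) => f r
    _ = _ := by
      simp only [Measure.volumeIoiPow, ENNReal.ofReal]
      rw [integral_withDensity_eq_integral_smul,
        integral_subtype_comap measurableSet_Ioi fun r => Real.toNNReal (r ^ 3) • f r,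
        setIntegral_congr_fun measurableSet_Ioi fun r hr => ?_]
      · rw [NNReal.smul_def, Real.coe_toNNReal _ (pow_nonneg hr.out.le _), smul_eq_mul]
      · exact (measurable_subtype_coe.pow_const _).real_toNNReal

theorem annulus_eq_preimage (τ σ : ℝ) :
    Metric.ball (0 : EuclideanSpace ℝ (Fin 4)) σ \ Metric.ball 0 τ = norm ⁻¹' Ico τ σ := by
  ext x
  simp [and_comm]

theorem setIntegral_annulus (f : ℝ → ℝ) (ψ : EuclideanSpace ℝ (Fin 4) → ℝ) {τ σ : ℝ}
    (hτ : 0 ≤ τ) (hτσ : τ ≤ σ) :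
    ∫ x in Metric.ball (0 : EuclideanSpace ℝ (Fin 4)) σ \ Metric.ball 0 τ,
        f ‖x‖ * ψ (‖x‖⁻¹ • x) =
      (∫ y : Metric.sphere (0 : EuclideanSpace ℝ (Fin 4)) 1, ψ y ∂(volume.toSphere)) *
        ∫ r in τ..σ, r ^ 3 * f r := by
  have h1 : ∀ x : EuclideanSpace ℝ (Fin 4),
      (norm ⁻¹' Ico τ σ).indicator (fun x => f ‖x‖ * ψ (‖x‖⁻¹ • x)) x =
        (Ico τ σ).indicator f ‖x‖ * ψ (‖x‖⁻¹ • x) := by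
    intro x
    by_cases h : ‖x‖ ∈ Ico τ σ
    · simp [indicator, h]
    · simp [indicator, h]
  have h2 : ∀ r : ℝ, r ^ 3 * (Ico τ σ).indicator f r =
      (Ico τ σ).indicator (fun r => r ^ 3 * f r) r := by
    intro r
    by_cases h : r ∈ Ico τ σ <;> simp [h]
  rw [annulus_eq_preimage, ← integral_indicator (measurableSet_Ico.preimage measurable_norm)]
  simp only [h1, integral_norm_mul_unit, h2]
  rw [← integral_Ici_eq_integral_Ioi, setIntegral_indicator measurableSet_Ico,
    inter_eq_right.2 (Ico_subset_Ici_self.trans (Ici_subset_Ici.2 hτ)),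
    intervalIntegral.integral_of_le hτσ,
    setIntegral_congr_set Ico_ae_eq_Ioc]

theorem toSphere_real_univ_four :
    (volume : Measure (EuclideanSpace ℝ (Fin 4))).toSphere.real univ = 2 * Real.pi ^ 2 := by
  have hG : Real.Gamma (4 / 2 + 1) = 2 := by
    rw [show (4 / 2 + 1 : ℝ) = (2 : ℕ) + 1 by norm_num, Real.Gamma_nat_eq_factorial]
    norm_num
  rw [Measure.toSphere_real_apply_univ, measureReal_def, EuclideanSpace.volume_ball]
  have hpi : √Real.pi ^ 4 = Real.pi ^ 2 := by
    rw [show 4 = 2 * 2 from rfl, pow_mul, Real.sq_sqrt Real.pi_pos.le]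
  simp only [finrank_euclideanSpace, Fintype.card_fin, Nat.cast_ofNat, hG, hpi]
  rw [ENNReal.ofReal_one, one_pow, one_mul, ENNReal.toReal_ofReal (by positivity)]
  ring

theorem setIntegral_ball_inner_sq_congr {a b : EuclideanSpace ℝ (Fin 4)} (h : ‖a‖ = ‖b‖) :
    ∫ x in Metric.ball (0 : EuclideanSpace ℝ (Fin 4)) 1, ⟪a, x⟫_ℝ ^ 2 =
      ∫ x in Metric.ball (0 : EuclideanSpace ℝ (Fin 4)) 1, ⟪b, x⟫_ℝ ^ 2 := by
  set R := (ℝ ∙ (a - b))ᗮ.reflection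
  have hR : R a = b := Submodule.reflection_sub h
  have := R.measurePreserving.setIntegral_preimage_emb R.toHomeomorph.measurableEmbedding
    (fun x => ⟪b, x⟫_ℝ ^ 2) (Metric.ball 0 1)
  rw [← this, ← hR]
  simp [R.preimage_ball]

theorem four_mul_setIntegral_ball_inner_sq (a : EuclideanSpace ℝ (Fin 4)) :
    4 * ∫ x in Metric.ball (0 : EuclideanSpace ℝ (Fin 4)) 1, ⟪a, x⟫_ℝ ^ 2 =
      ‖a‖ ^ 2 * ∫ x in Metric.ball (0 : EuclideanSpace ℝ (Fin 4)) 1, ‖x‖ ^ 2 := by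
  have hint (i : Fin 4) : IntegrableOn (fun x : EuclideanSpace ℝ (Fin 4) => x i ^ 2)
      (Metric.ball 0 1) :=
    (ContinuousOn.integrableOn_compact (isCompact_closedBall 0 1) (by fun_prop)).mono_set
      Metric.ball_subset_closedBall
  have h1 (i : Fin 4) : ∫ x in Metric.ball (0 : EuclideanSpace ℝ (Fin 4)) 1, ⟪a, x⟫_ℝ ^ 2 =
      ‖a‖ ^ 2 * ∫ x in Metric.ball (0 : EuclideanSpace ℝ (Fin 4)) 1, x i ^ 2 := by
    rw [setIntegral_ball_inner_sq_congr (b := EuclideanSpace.single i ‖a‖) (by simp),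
      ← integral_const_mul]
    simp [EuclideanSpace.inner_single_left, mul_pow, mul_comm]
  have h2 : ∀ x : EuclideanSpace ℝ (Fin 4), ‖x‖ ^ 2 = ∑ i, x i ^ 2 :=
    EuclideanSpace.real_norm_sq_eq
  rw [integral_congr_ae (.of_forall h2), integral_finsetSum _ fun i _ => hint i, Finset.mul_sum,
    ← Finset.sum_congr rfl fun i _ => h1 i]
  simp

theorem norm_sq_eq_four_of_sphere_integral {a : EuclideanSpace ℝ (Fin 4)}
    (ha : (∫ y : Metric.sphere (0 : EuclideanSpace ℝ (Fin 4)) 1,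
      ⟪a, (y : EuclideanSpace ℝ (Fin 4))⟫_ℝ ^ 2 ∂(volume.toSphere)) = 2 * Real.pi ^ 2) :
    ‖a‖ ^ 2 = 4 := by
  have h0 : Metric.ball (0 : EuclideanSpace ℝ (Fin 4)) 1 \ Metric.ball 0 0 = Metric.ball 0 1 := by
    simp
  have hsq (x : EuclideanSpace ℝ (Fin 4)) : ‖x‖ ^ 2 * ⟪a, ‖x‖⁻¹ • x⟫_ℝ ^ 2 = ⟪a, x⟫_ℝ ^ 2 := by
    rcases eq_or_ne x 0 with rfl | hx
    · simp
    · have : ‖x‖ ≠ 0 := by simpa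
      rw [inner_smul_right]
      field_simp
  have h1 := setIntegral_annulus (fun r => r ^ 2) (fun y => ⟪a, y⟫_ℝ ^ 2) le_rfl zero_le_one
  have h2 := setIntegral_annulus (fun r => r ^ 2) (fun _ => 1) le_rfl zero_le_one
  have hr : ∫ r in (0 : ℝ)..1, r ^ 3 * r ^ 2 = 1 / 6 := by
    simp only [← pow_add]
    rw [integral_pow]
    norm_num
  simp only [hsq, h0, ha, hr] at h1
  simp only [h0, hr, mul_one, integral_const, toSphere_real_univ_four, smul_eq_mul] at h2
  have h3 := four_mul_setIntegral_ball_inner_sq a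
  rw [h1, h2] at h3
  have hpi : 2 * Real.pi ^ 2 * (1 / 6) ≠ 0 := by positivity
  exact (mul_right_cancel₀ hpi h3).symm

/-- the triharmonic bilinear forms of the basis functions
`uᵢ(x) = Fᵢ(|x|) X(x/|x|)`, where `X` is a degree-one spherical harmonic normalized by
`∫_{S³} X² dA = 2π²`, over the annulus `B_σ(0) \ B_τ(0)` in `ℝ⁴`. -/
theorem stmt10 (X : EuclideanSpace ℝ (Fin 4) → ℝ) (hX : IsHarmonicHomog 1 X)
    (hXnorm : (∫ y : Metric.sphere (0 : EuclideanSpace ℝ (Fin 4)) 1,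
        (X (y : EuclideanSpace ℝ (Fin 4))) ^ 2 ∂(MeasureTheory.volume.toSphere))
      = 2 * Real.pi ^ 2)
    (τ σ : ℝ) (hτ : 0 < τ) (hτσ : τ < σ) (i j : Fin 6) :
    (∫ x in Metric.ball (0 : EuclideanSpace ℝ (Fin 4)) σ \ Metric.ball 0 τ,
        ⟪gradient (lap fun y => FF i ‖y‖ * X (‖y‖⁻¹ • y)) x,
         gradient (lap fun y => FF j ‖y‖ * X (‖y‖⁻¹ • y)) x⟫_ℝ)
      = 16 * (2 * Real.pi ^ 2) * (Nmat σ - Nmat τ) i j := by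
  obtain ⟨⟨p, hp, hXp⟩, -⟩ := hX
  obtain ⟨a, ha⟩ := hp.exists_eval_eq_inner
  obtain rfl : X = fun x => ⟪a, x⟫_ℝ := funext fun x => (hXp x).trans (ha x)
  have ha4 : ‖a‖ ^ 2 = 4 := norm_sq_eq_four_of_sphere_integral hXnorm
  set A : ℝ → ℝ := fun r => 4 * (lapProfile i (r ^ 2) * lapProfile j (r ^ 2)) with hA
  set B : ℝ → ℝ := fun r => (2 * lapProfile i (r ^ 2) * lapProfileDeriv j (r ^ 2) +
    2 * lapProfileDeriv i (r ^ 2) * lapProfile j (r ^ 2) +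
    4 * r ^ 2 * lapProfileDeriv i (r ^ 2) * lapProfileDeriv j (r ^ 2)) * r ^ 2 with hB
  have hsq : MapsTo (fun r : ℝ => r ^ 2) (Icc τ σ) {0}ᶜ := fun r hr => by
    simpa using (hτ.trans_le hr.1).ne'
  have hl (k : Fin 6) : ContinuousOn (fun r => lapProfile k (r ^ 2)) (Icc τ σ) :=
    (continuousOn_lapProfile k).comp (by fun_prop) hsq
  have hl' (k : Fin 6) : ContinuousOn (fun r => lapProfileDeriv k (r ^ 2)) (Icc τ σ) :=
    (continuousOn_lapProfileDeriv k).comp (by fun_prop) hsq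
  have hAc : ContinuousOn A (Icc τ σ) := by fun_prop
  have hBc : ContinuousOn B (Icc τ σ) := by fun_prop
  have hsub : Metric.ball (0 : EuclideanSpace ℝ (Fin 4)) σ \ Metric.ball 0 τ ⊆
      Metric.closedBall 0 σ \ Metric.ball 0 τ :=
    sdiff_subset_sdiff_left Metric.ball_subset_closedBall
  have hcpt : IsCompact (Metric.closedBall (0 : EuclideanSpace ℝ (Fin 4)) σ \ Metric.ball 0 τ) :=
    (isCompact_closedBall _ _).diff Metric.isOpen_ball
  have hmaps : MapsTo norm (Metric.closedBall (0 : EuclideanSpace ℝ (Fin 4)) σ \ Metric.ball 0 τ)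
      (Icc τ σ) := fun x hx => by simpa [and_comm] using hx
  have hne : ∀ x ∈ Metric.closedBall (0 : EuclideanSpace ℝ (Fin 4)) σ \ Metric.ball 0 τ,
      ‖x‖ ≠ 0 := fun x hx => (hτ.trans_le (hmaps hx).1).ne'
  have hAi : IntegrableOn (fun x : EuclideanSpace ℝ (Fin 4) => A ‖x‖ * 1)
      (Metric.ball 0 σ \ Metric.ball 0 τ) :=
    (((hAc.comp continuous_norm.continuousOn hmaps).mul
      continuousOn_const).integrableOn_compact hcpt).mono_set hsub
  have hBi : IntegrableOn (fun x : EuclideanSpace ℝ (Fin 4) => B ‖x‖ * ⟪a, ‖x‖⁻¹ • x⟫_ℝ ^ 2)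
      (Metric.ball 0 σ \ Metric.ball 0 τ) := by
    refine (ContinuousOn.integrableOn_compact hcpt ?_).mono_set hsub
    refine (hBc.comp continuous_norm.continuousOn hmaps).mul ?_
    have : ContinuousOn (fun x : EuclideanSpace ℝ (Fin 4) => ‖x‖⁻¹)
      (Metric.closedBall 0 σ \ Metric.ball 0 τ) := continuous_norm.continuousOn.inv₀ hne
    fun_prop
  have hpt : EqOn (fun x : EuclideanSpace ℝ (Fin 4) =>
      ⟪gradient (lap fun y => FF i ‖y‖ * ⟪a, ‖y‖⁻¹ • y⟫_ℝ) x,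
        gradient (lap fun y => FF j ‖y‖ * ⟪a, ‖y‖⁻¹ • y⟫_ℝ) x⟫_ℝ)
      (fun x => A ‖x‖ * 1 + B ‖x‖ * ⟪a, ‖x‖⁻¹ • x⟫_ℝ ^ 2)
      (Metric.ball 0 σ \ Metric.ball 0 τ) := fun x hx => by
    simp only [inner_gradient_lap_eq i j a (norm_ne_zero_iff.1 (hne x (hsub hx))), ha4, hA, hB,
      mul_one]
  rw [setIntegral_congr_fun (measurableSet_ball.diff measurableSet_ball) hpt,
    integral_add hAi hBi, setIntegral_annulus A (fun _ => 1) hτ.le hτσ.le,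
    setIntegral_annulus B (fun y => ⟪a, y⟫_ℝ ^ 2) hτ.le hτσ.le, hXnorm]
  have hIA : IntervalIntegrable (fun r => r ^ 3 * A r) volume τ σ :=
    ContinuousOn.intervalIntegrable (by rw [uIcc_of_le hτσ.le]; fun_prop)
  have hIB : IntervalIntegrable (fun r => r ^ 3 * B r) volume τ σ :=
    ContinuousOn.intervalIntegrable (by rw [uIcc_of_le hτσ.le]; fun_prop)
  have hderiv : ∀ r ∈ uIcc τ σ, HasDerivAt (fun r => 16 * Nmat r i j)
      (r ^ 3 * A r + r ^ 3 * B r) r := fun r hr => by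
    rw [uIcc_of_le hτσ.le] at hr
    have hr0 : r ≠ 0 := (hτ.trans_le hr.1).ne'
    simpa only [NmatDeriv_eq i j hr0] using (hasDerivAt_Nmat i j hr0).const_mul 16
  have hFTC := intervalIntegral.integral_eq_sub_of_hasDerivAt hderiv (hIA.add hIB)
  rw [intervalIntegral.integral_add hIA hIB] at hFTC
  simp only [integral_const, toSphere_real_univ_four, smul_eq_mul, mul_one, Matrix.sub_apply]
  linear_combination 2 * Real.pi ^ 2 * hFTC
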